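/- arXiv:1007.4915 — 2 statements merged into one kernel-verified Lean document; each statement's English description precedes it below -/
import Mathlib

section
/- Let n ≥ 2 and let F ⊆ {-1,1}^n be a finite set with VC dimension d satisfying 1 ≤ d ≤ n/2, and suppose F is γ-orthogonal for some γ ∈ [0,1), i.e. every pair of distinct x, y ∈ F satisfies |⟨x,y⟩| ≤ γ. Then |F| ≤ 100 · 2^{d·β(γ)}. -/
open Finset

/-- Binary entropy function (base 2). -/
noncomputable def binH (x : ℝ) : ℝ := -x * Real.logb 2 x - (1 - x) * Real.logb 2 (1 - x)

/-- Normalized inner product on `{-1,1}^n`. -/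
noncomputable def ipNorm (n : ℕ) (x y : Fin n → ℤ) : ℝ := ((∑ i, x i * y i : ℤ) : ℝ) / n

/-- `F` shatters the index set `I`: every `±1` pattern on `I` is realized by some `x ∈ F`. -/
def Shatters (n : ℕ) (F : Finset (Fin n → ℤ)) (I : Finset (Fin n)) : Prop :=
  ∀ g : Fin n → ℤ, (∀ i ∈ I, g i = 1 ∨ g i = -1) → ∃ x ∈ F, ∀ i ∈ I, x i = g i

/-- Binomial expectation. -/
noncomputable def bE (p : ℝ) (k : ℕ) (f : ℕ → ℝ) : ℝ :=
  ∑ i ∈ range (k + 1), (k.choose i : ℝ) * p ^ i * (1 - p) ^ (k - i) * f i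

lemma bE_succ (p : ℝ) (k : ℕ) (f : ℕ → ℝ) :
    bE p (k + 1) f = p * bE p k (fun i => f (i + 1)) + (1 - p) * bE p k f := by
  unfold bE
  rw [sum_range_succ', mul_sum, mul_sum]
  have h1 : ∑ i ∈ range (k + 1), (1 - p) * ((k.choose i : ℝ) * p ^ i * (1 - p) ^ (k - i) * f i)
      = ∑ i ∈ range (k + 2), ((k.choose i : ℝ) * p ^ i * (1 - p) ^ (k + 1 - i) * f i) := by
    rw [sum_range_succ _ (k + 1)]
    simp only [Nat.choose_succ_self, Nat.cast_zero, zero_mul, add_zero]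
    refine sum_congr rfl fun i hi => ?_
    have : k + 1 - i = (k - i) + 1 := by have := mem_range.1 hi; omega
    rw [this, pow_succ]; ring
  rw [h1, sum_range_succ' _ (k + 1), ← add_assoc, ← sum_add_distrib]
  congr 1
  · refine sum_congr rfl fun i hi => ?_
    rw [Nat.choose_succ_succ]
    have : k + 1 - (i + 1) = k - i := by omega
    rw [this]; push_cast; ring
  · simp

lemma bE_mono {p : ℝ} (h0 : 0 ≤ p) (h1 : p ≤ 1) (k : ℕ) {f g : ℕ → ℝ}
    (h : ∀ i, f i ≤ g i) : bE p k f ≤ bE p k g := by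
  unfold bE
  refine sum_le_sum fun i _ => ?_
  have : 0 ≤ 1 - p := by linarith
  exact mul_le_mul_of_nonneg_left (h i) (by positivity)

lemma bE_add (p : ℝ) (k : ℕ) (f g : ℕ → ℝ) :
    bE p k (fun i => f i + g i) = bE p k f + bE p k g := by
  unfold bE
  rw [← sum_add_distrib]
  exact sum_congr rfl fun i _ => by ring

lemma bE_smul (p : ℝ) (k : ℕ) (c : ℝ) (f : ℕ → ℝ) :
    bE p k (fun i => c * f i) = c * bE p k f := by
  unfold bE
  rw [mul_sum]
  exact sum_congr rfl fun i _ => by ring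

lemma bE_one (p : ℝ) (k : ℕ) : bE p k (fun _ => 1) = 1 := by
  induction k with
  | zero => simp [bE]
  | succ k ih => rw [bE_succ, ih]; ring

lemma bE_m1 (p : ℝ) (k : ℕ) (y : ℝ) : bE p k (fun i => (i : ℝ) + y) = y + k * p := by
  induction k generalizing y with
  | zero => simp [bE]
  | succ k ih =>
    rw [bE_succ, ih]
    have : (fun i : ℕ => ((i + 1 : ℕ) : ℝ) + y) = fun i : ℕ => (i : ℝ) + (y + 1) := by
      funext i; push_cast; ring
    rw [this, ih]; push_cast; ring

lemma bE_m2 (p : ℝ) (k : ℕ) (y : ℝ) :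
    bE p k (fun i => ((i : ℝ) + y) ^ 2) = (y + k * p) ^ 2 + k * p * (1 - p) := by
  induction k generalizing y with
  | zero => simp [bE]
  | succ k ih =>
    rw [bE_succ, ih]
    have : (fun i : ℕ => (((i + 1 : ℕ) : ℝ) + y) ^ 2) = fun i : ℕ => ((i : ℝ) + (y + 1)) ^ 2 := by
      funext i; push_cast; ring
    rw [this, ih]; push_cast; ring

lemma bE_m4 (p : ℝ) (k : ℕ) (y : ℝ) :
    bE p k (fun i => ((i : ℝ) + y) ^ 4) = (y + k * p) ^ 4 + 6 * (k * p * (1 - p)) * (y + k * p) ^ 2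
      + 4 * (k * p * (1 - p)) * (1 - 2 * p) * (y + k * p)
      + 3 * (k * p * (1 - p)) ^ 2 + k * p * (1 - p) * (1 - 6 * p * (1 - p)) := by
  induction k generalizing y with
  | zero => simp [bE]
  | succ k ih =>
    rw [bE_succ, ih]
    have : (fun i : ℕ => (((i + 1 : ℕ) : ℝ) + y) ^ 4) = fun i : ℕ => ((i : ℝ) + (y + 1)) ^ 4 := by
      funext i; push_cast; ring
    rw [this, ih]; push_cast; ring

lemma quartic_bound (t Y : ℝ) : 2 * t ^ 3 * Y + 3 * t ^ 2 * Y ^ 2 - Y ^ 4 ≤ 5 * t ^ 4 := by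
  nlinarith [sq_nonneg (Y ^ 2 - 187 / 100 * t ^ 2), sq_nonneg (t * (37 * Y - 50 * t)),
    sq_nonneg (t ^ 2)]

lemma quartic_neg (t Y : ℝ) (ht : 0 ≤ t) (hY : Y ≤ 0) :
    2 * t ^ 3 * Y + 3 * t ^ 2 * Y ^ 2 - Y ^ 4 ≤ 0 := by
  have : 2 * t ^ 3 * Y + 3 * t ^ 2 * Y ^ 2 - Y ^ 4 = Y * ((Y + t) ^ 2 * (2 * t - Y)) := by ring
  rw [this]
  exact mul_nonpos_of_nonpos_of_nonneg hY (mul_nonneg (sq_nonneg _) (by linarith))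

lemma tail_bound (p : ℝ) (hp0 : 0 < p) (hp : p ≤ 1 / 2) (k d : ℕ) (hd : 1 ≤ d)
    (hk : (d : ℝ) ≤ k * p) : bE p k (fun i => if i ≤ d then 1 else 0) ≤ 1 - 7 / 80 := by
  set v : ℝ := k * p * (1 - p) with hv
  have hd' : (1 : ℝ) ≤ d := by exact_mod_cast hd
  have hv2 : 1 / 2 ≤ v := by rw [hv]; nlinarith
  obtain ⟨t, ht, htv⟩ : ∃ t : ℝ, 0 < t ∧ t ^ 2 = 4 * v :=
    ⟨Real.sqrt (4 * v), Real.sqrt_pos.2 (by linarith), Real.sq_sqrt (by linarith)⟩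
  have ht4 : t ^ 4 = 16 * v ^ 2 := by
    calc t ^ 4 = (t ^ 2) ^ 2 := by ring
      _ = _ := by rw [htv]; ring
  set c : ℝ := 1 / (5 * t ^ 4) with hc
  have hc0 : 0 < c := by positivity
  have hct : c * (5 * t ^ 4) = 1 := by rw [hc]; field_simp
  have key : bE p k (fun i => if i ≤ d then 1 else 0) ≤
      bE p k (fun i => 1 + ((-c * (2 * t ^ 3)) * ((i : ℝ) + (-(k * p))) +
        ((-c * (3 * t ^ 2)) * ((i : ℝ) + (-(k * p))) ^ 2 + c * ((i : ℝ) + (-(k * p))) ^ 4))) := by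
    refine bE_mono hp0.le (by linarith) k fun i => ?_
    split_ifs with h
    · have hi : (i : ℝ) ≤ d := by exact_mod_cast h
      have := quartic_neg t ((i : ℝ) + (-(k * p))) ht.le (by linarith)
      nlinarith
    · have := quartic_bound t ((i : ℝ) + (-(k * p)))
      nlinarith
  rw [bE_add, bE_add, bE_add, bE_smul, bE_smul, bE_smul, bE_one, bE_m1, bE_m2, bE_m4, ← hv, htv]
    at key
  refine key.trans ?_
  have hpq : 0 ≤ p * (1 - p) := mul_nonneg hp0.le (by linarith)
  have h1 : v * (1 - 6 * p * (1 - p)) ≤ 2 * v ^ 2 := by nlinarith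
  rw [ht4] at hct
  have h2 := mul_le_mul_of_nonneg_left h1 hc0.le
  nlinarith

lemma choose_sum_bound (p : ℝ) (hp0 : 0 < p) (hp : p ≤ 1 / 2) (k d : ℕ) (hd : 1 ≤ d)
    (hk : (d : ℝ) ≤ k * p) :
    ((∑ i ∈ Iic d, k.choose i : ℕ) : ℝ) ≤ (1 - 7 / 80) * (2 : ℝ) ^ ((k : ℝ) * binH p) := by
  set M : ℝ := (2 : ℝ) ^ ((k : ℝ) * binH p) with hM
  have hM0 : 0 < M := by positivity
  have hq : 0 < 1 - p := by linarith
  have hdk : d ≤ k := by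
    have : (d : ℝ) ≤ k := by nlinarith [(Nat.cast_nonneg k : (0:ℝ) ≤ k)]
    exact_mod_cast this
  have hterm : ∀ i ≤ d, 1 ≤ M * (p ^ i * (1 - p) ^ (k - i)) := by
    intro i hi
    have hl2 : 0 < Real.log 2 := Real.log_pos (by norm_num)
    have hMe : M = Real.exp (k * (-p * Real.log p - (1 - p) * Real.log (1 - p))) := by
      rw [hM, Real.rpow_def_of_pos (by norm_num)]
      congr 1
      unfold binH Real.logb
      field_simp
    have hpe : p ^ i = Real.exp (i * Real.log p) := by
      rw [mul_comm, Real.exp_mul, Real.exp_log hp0, Real.rpow_natCast]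
    have hqe : (1 - p) ^ (k - i) = Real.exp ((k - i) * Real.log (1 - p)) := by
      rw [mul_comm, Real.exp_mul, Real.exp_log hq, ← Nat.cast_sub (by omega), Real.rpow_natCast]
    rw [hMe, hpe, hqe, ← Real.exp_add, ← Real.exp_add]
    apply Real.one_le_exp
    have hlog : Real.log p ≤ Real.log (1 - p) := Real.log_le_log hp0 (by linarith)
    have hid : (i : ℝ) ≤ d := by exact_mod_cast hi
    have := mul_nonneg (show 0 ≤ k * p - (i : ℝ) by linarith) (sub_nonneg.2 hlog)
    nlinarith
  have h1 : ((∑ i ∈ Iic d, k.choose i : ℕ) : ℝ) ≤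
      M * bE p k (fun i => if i ≤ d then 1 else 0) := by
    unfold bE
    rw [mul_sum]
    push_cast
    have hsub : Iic d ⊆ range (k + 1) := by
      intro i hi; have := mem_Iic.1 hi; exact mem_range.2 (by omega)
    refine (sum_le_sum (g := fun i => M * ((k.choose i : ℝ) * p ^ i * (1 - p) ^ (k - i) *
      (if i ≤ d then 1 else 0))) fun i hi => ?_).trans
      (sum_le_sum_of_subset_of_nonneg hsub fun i _ _ => ?_)
    · rw [if_pos (mem_Iic.1 hi)]
      have := mul_le_mul_of_nonneg_left (hterm i (mem_Iic.1 hi))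
        (Nat.cast_nonneg (k.choose i) : (0:ℝ) ≤ _)
      linarith
    · split_ifs <;> positivity
  have h2 := mul_le_mul_of_nonneg_left (tail_bound p hp0 hp k d hd hk) hM0.le
  linarith

lemma sauer_step (n d k : ℕ) (F : Finset (Fin n → ℤ))
    (hpm : ∀ x ∈ F, ∀ i, x i = 1 ∨ x i = -1)
    (hd : ∀ I : Finset (Fin n), _root_.Shatters n F I → I.card ≤ d) (s : Fin k → Fin n) :
    (F.image (fun x => univ.filter (fun j => x (s j) = 1))).card ≤ ∑ i ∈ Iic d, k.choose i := by
  classical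
  set A := F.image (fun x => univ.filter (fun j => x (s j) = 1)) with hA
  have hvc : A.vcDim ≤ d := by
    unfold Finset.vcDim
    refine Finset.sup_le fun J hJ => ?_
    rw [mem_shatterer] at hJ
    have hinj : Set.InjOn s J := by
      intro a ha b hb hab
      by_contra hne
      obtain ⟨u, hu, hJu⟩ := hJ (t := {a}) (by simpa using ha)
      obtain ⟨x, hx, rfl⟩ := mem_image.1 hu
      have h1 : x (s a) = 1 := by
        have : a ∈ J ∩ univ.filter (fun j => x (s j) = 1) := by rw [hJu]; simp
        simpa using (mem_inter.1 this).2
      have h2 : b ∈ J ∩ univ.filter (fun j => x (s j) = 1) := by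
        simp only [mem_inter, mem_filter, mem_univ, true_and]
        exact ⟨hb, hab ▸ h1⟩
      rw [hJu] at h2
      exact hne (mem_singleton.1 h2).symm
    rw [← card_image_of_injOn hinj]
    apply hd
    intro g hg
    obtain ⟨u, hu, hJu⟩ := hJ (t := J.filter (fun j => g (s j) = 1)) (filter_subset _ _)
    obtain ⟨x, hx, rfl⟩ := mem_image.1 hu
    refine ⟨x, hx, fun i hi => ?_⟩
    obtain ⟨j, hj, rfl⟩ := mem_image.1 hi
    have h := Finset.ext_iff.1 hJu j
    simp only [mem_inter, mem_filter, mem_univ, true_and, hj] at h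
    rcases hpm x hx (s j) with h1 | h1
    · rw [h1, h.1 h1]
    · rcases hg _ hi with h2 | h2
      · rw [h2, h.2 h2]
      · rw [h1, h2]
  calc A.card ≤ A.shatterer.card := card_le_card_shatterer A
    _ ≤ ∑ i ∈ Iic A.vcDim, (Fintype.card (Fin k)).choose i := card_shatterer_le_sum_vcDim
    _ ≤ _ := by
      rw [Fintype.card_fin]
      exact sum_le_sum_of_subset (Iic_subset_Iic.2 hvc)

lemma collision {α β : Type*} [DecidableEq β] (F : Finset α) (φ : α → β) :
    F.card ^ 2 ≤ (F.image φ).card * ∑ x ∈ F, ∑ y ∈ F, (if φ x = φ y then 1 else 0) := by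
  have h1 : F.card = ∑ b ∈ F.image φ, (F.filter (fun a => φ a = b)).card :=
    card_eq_sum_card_image φ F
  have h2 : ∑ x ∈ F, ∑ y ∈ F, (if φ x = φ y then 1 else 0) =
      ∑ b ∈ F.image φ, (F.filter (fun a => φ a = b)).card ^ 2 := by
    rw [← sum_fiberwise_of_maps_to (g := φ) (t := F.image φ) fun x hx => mem_image_of_mem _ hx]
    refine sum_congr rfl fun b _ => ?_
    rw [sq, ← smul_eq_mul, ← sum_const]
    refine sum_congr rfl fun x hx => ?_
    rw [card_filter]
    refine sum_congr rfl fun y _ => ?_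
    rw [(mem_filter.1 hx).2]
    simp only [eq_comm]
  rw [h2]
  calc F.card ^ 2 = (∑ b ∈ F.image φ, (F.filter (fun a => φ a = b)).card) ^ 2 := by rw [← h1]
    _ ≤ _ := by
      have := sq_sum_le_card_mul_sum_sq (s := F.image φ)
        (f := fun b => ((F.filter (fun a => φ a = b)).card : ℤ))
      exact_mod_cast this

lemma agree_count (n k : ℕ) (x y : Fin n → ℤ) (hx : ∀ i, x i = 1 ∨ x i = -1)
    (hy : ∀ i, y i = 1 ∨ y i = -1) :
    (∑ s : Fin k → Fin n, (if univ.filter (fun j => x (s j) = 1) =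
      univ.filter (fun j => y (s j) = 1) then 1 else 0)) =
      (univ.filter (fun i => x i = y i)).card ^ k := by
  rw [← card_filter]
  have : (univ.filter (fun s : Fin k → Fin n => univ.filter (fun j => x (s j) = 1) =
      univ.filter (fun j => y (s j) = 1))) =
      Fintype.piFinset (fun _ : Fin k => univ.filter (fun i => x i = y i)) := by
    ext s
    simp only [mem_filter, mem_univ, true_and, Fintype.mem_piFinset, Finset.ext_iff]
    refine forall_congr' fun j => ?_
    rcases hx (s j) with h | h <;> rcases hy (s j) with h' | h' <;> rw [h, h'] <;> norm_num
  rw [this, Fintype.card_piFinset]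
  simp

lemma agree_card (n : ℕ) (x y : Fin n → ℤ) (hx : ∀ i, x i = 1 ∨ x i = -1)
    (hy : ∀ i, y i = 1 ∨ y i = -1) :
    2 * ((univ.filter (fun i => x i = y i)).card : ℤ) = n + ∑ i, x i * y i := by
  rw [card_filter]
  push_cast
  have : (n : ℤ) = ∑ i : Fin n, 1 := by simp
  rw [this, mul_sum, ← sum_add_distrib]
  refine sum_congr rfl fun i _ => ?_
  rcases hx i with h | h <;> rcases hy i with h' | h' <;> rw [h, h'] <;> norm_num

theorem stmt0 (n d : ℕ) (hn : 2 ≤ n) (F : Finset (Fin n → ℤ))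
    (hpm : ∀ x ∈ F, ∀ i, x i = 1 ∨ x i = -1)
    (hd1 : 1 ≤ d) (hd2 : (d : ℝ) ≤ (n : ℝ) / 2)
    (hdvc : IsGreatest {k : ℕ | ∃ I : Finset (Fin n), I.card = k ∧ Shatters n F I} d)
    (γ : ℝ) (hγ0 : 0 ≤ γ) (hγ1 : γ < 1)
    (horth : ∀ x ∈ F, ∀ y ∈ F, x ≠ y → |ipNorm n x y| ≤ γ)
    (hinv : ℝ) (hinv0 : 0 ≤ hinv) (hinv12 : hinv ≤ 1 / 2)
    (hinvH : binH hinv = Real.logb 2 (2 / (1 + γ))) :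
    (F.card : ℝ) ≤ 100 * (2 : ℝ) ^ ((d : ℝ) * (1 / hinv)) := by
  have hn0 : (0 : ℝ) < n := by exact_mod_cast (by omega : 0 < n)
  have hHpos : 0 < Real.logb 2 (2 / (1 + γ)) := by
    apply Real.logb_pos (by norm_num)
    rw [lt_div_iff₀ (by linarith)]; linarith
  have hp0 : 0 < hinv := by
    rcases hinv0.eq_or_lt with h | h
    · rw [← hinvH, ← h] at hHpos
      simp [binH] at hHpos
    · exact h
  have hH1 : binH hinv ≤ 1 := by
    rw [hinvH, Real.logb_le_iff_le_rpow (by norm_num) (by positivity), Real.rpow_one,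
      div_le_iff₀ (by linarith)]
    linarith
  set k : ℕ := ⌈(d : ℝ) / hinv⌉₊ with hk
  have hk1 : (d : ℝ) ≤ k * hinv := by
    rw [← div_le_iff₀ hp0]; exact Nat.le_ceil _
  have hk2 : (k : ℝ) ≤ (d : ℝ) * (1 / hinv) + 1 := by
    rw [mul_one_div]; exact (Nat.ceil_lt_add_one (by positivity)).le
  have hN := choose_sum_bound hinv hp0 hinv12 k d hd1 hk1
  set N : ℕ := ∑ i ∈ Iic d, k.choose i with hNdef
  set M : ℝ := (2 : ℝ) ^ ((k : ℝ) * binH hinv) with hM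
  have hMk : M = (2 / (1 + γ)) ^ k := by
    rw [hM, mul_comm, Real.rpow_mul (by norm_num), hinvH,
      Real.rpow_logb (by norm_num) (by norm_num) (by positivity), Real.rpow_natCast]
  have hM0 : 0 < M := by positivity
  have hMle : M ≤ 2 * (2 : ℝ) ^ ((d : ℝ) * (1 / hinv)) := by
    calc M ≤ (2 : ℝ) ^ ((d : ℝ) * (1 / hinv) + 1) := by
          apply Real.rpow_le_rpow_of_exponent_le (by norm_num)
          nlinarith [(Nat.cast_nonneg k : (0:ℝ) ≤ k)]
      _ = _ := by rw [Real.rpow_add (by norm_num), Real.rpow_one]; ring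
  have hvc : ∀ I : Finset (Fin n), _root_.Shatters n F I → I.card ≤ d :=
    fun I hI => hdvc.2 ⟨I, rfl, hI⟩
  -- double counting
  have hcount : n ^ k * F.card ^ 2 ≤
      N * ∑ x ∈ F, ∑ y ∈ F, (univ.filter (fun i => x i = y i)).card ^ k := by
    have h1 : ∀ s : Fin k → Fin n, F.card ^ 2 ≤ N * ∑ x ∈ F, ∑ y ∈ F,
        (if univ.filter (fun j => x (s j) = 1) = univ.filter (fun j => y (s j) = 1)
          then 1 else 0) := fun s =>
      (collision F (fun x => univ.filter (fun j => x (s j) = 1))).trans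
        (Nat.mul_le_mul_right _ (sauer_step n d k F hpm hvc s))
    have h2 := sum_le_sum fun s (_ : s ∈ (univ : Finset (Fin k → Fin n))) => h1 s
    rw [sum_const, card_univ, Fintype.card_fun, Fintype.card_fin, Fintype.card_fin, smul_eq_mul,
      ← mul_sum, sum_comm] at h2
    refine h2.trans (le_of_eq ?_)
    congr 1
    refine sum_congr rfl fun x hx => ?_
    rw [sum_comm]
    exact sum_congr rfl fun y hy => agree_count n k x y (hpm x hx) (hpm y hy)
  have hpair : ∀ x ∈ F, ∀ y ∈ F, ((univ.filter (fun i => x i = y i)).card : ℝ) ^ k ≤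
      (n : ℝ) ^ k * ((if x = y then 1 else 0) + 1 / M) := by
    intro x hx y hy
    have hMi : 0 ≤ 1 / M := by positivity
    split_ifs with h
    · subst h
      simp only [filter_true, card_univ, Fintype.card_fin]
      have : (0 : ℝ) ≤ (n : ℝ) ^ k := by positivity
      nlinarith
    · have ha := agree_card n x y (hpm x hx) (hpm y hy)
      have ha' : 2 * ((univ.filter (fun i => x i = y i)).card : ℝ) =
          n + ((∑ i, x i * y i : ℤ) : ℝ) := by exact_mod_cast ha
      have ho := (abs_le.1 (horth x hx y hy h)).2
      unfold ipNorm at ho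
      rw [div_le_iff₀ hn0] at ho
      have hle : ((univ.filter (fun i => x i = y i)).card : ℝ) ≤ n * ((1 + γ) / 2) := by linarith
      have : 1 / M = ((1 + γ) / 2) ^ k := by
        rw [hMk, one_div, ← inv_pow, inv_div]
      rw [zero_add, this, ← mul_pow]
      exact pow_le_pow_left₀ (by positivity) hle k
  have hsum : ((∑ x ∈ F, ∑ y ∈ F, (univ.filter (fun i => x i = y i)).card ^ k : ℕ) : ℝ) ≤
      (n : ℝ) ^ k * (F.card + F.card ^ 2 * (1 / M)) := by
    push_cast
    refine (sum_le_sum fun x hx => sum_le_sum fun y hy => hpair x hx y hy).trans (le_of_eq ?_)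
    simp only [← mul_sum, sum_add_distrib, sum_ite_eq, sum_const, nsmul_eq_mul]
    congr 1
    rw [sum_congr rfl fun x hx => if_pos hx]
    simp
    ring
  have hfin : (n : ℝ) ^ k * (F.card : ℝ) ^ 2 ≤
      N * ((n : ℝ) ^ k * (F.card + F.card ^ 2 * (1 / M))) := by
    have : (n : ℝ) ^ k * (F.card : ℝ) ^ 2 ≤
      N * ((∑ x ∈ F, ∑ y ∈ F, (univ.filter (fun i => x i = y i)).card ^ k : ℕ) : ℝ) := by
      exact_mod_cast hcount
    exact this.trans (mul_le_mul_of_nonneg_left hsum (Nat.cast_nonneg _))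
  have hnk : (0 : ℝ) < (n : ℝ) ^ k := by positivity
  have hf2 : (F.card : ℝ) ^ 2 ≤ N * (F.card + F.card ^ 2 * (1 / M)) := by
    refine le_of_mul_le_mul_left ?_ hnk
    linarith
  have hf3 : (F.card : ℝ) ^ 2 ≤ (1 - 7 / 80) * M * (F.card + F.card ^ 2 * (1 / M)) :=
    hf2.trans (mul_le_mul_of_nonneg_right hN (by positivity))
  have hf4 : (1 - 7 / 80) * M * (F.card + F.card ^ 2 * (1 / M)) =
      (1 - 7 / 80) * (M * F.card + (F.card : ℝ) ^ 2) := by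
    field_simp
  rw [hf4] at hf3
  rcases (Nat.cast_nonneg F.card : (0:ℝ) ≤ F.card).eq_or_lt with h | h
  · rw [← h]; positivity
  · have : (F.card : ℝ) * F.card ≤ (F.card : ℝ) * (50 * M) := by nlinarith
    have := le_of_mul_le_mul_left this h
    linarith
end

section
/- Let k ≥ 2, n ∈ ℕ, and let F ⊆ {0,1,…,k-1}^n be a finite set. Let d be an integer with 6k/(k+1.6) ≤ d ≤ nk/(k+1.6), and assume F satisfies the generalized Sauer bound: for every r ≤ n and every index set I ⊆ {1,…,n} of size r, the projection of F onto the coordinates in I has cardinality at most Σ_{i=0}^{d} C(r,i)·k^i. Suppose γ ∈ (0,1) is such that every pair of distinct x, y ∈ F satisfies |γ_k(x,y)| ≤ γ, where γ_k(x,y) = 1 - (k/(k-1))·ρ(x,y) and ρ is the normalized Hamming distance. Then |F| ≤ 34 · k^d · 2^{d/δ(γ,k)}, where δ(γ,k) is the largest x ∈ [0, k/(k+1)] for which x·log₂ k + H(x) ≤ log₂(k/(1+(k-1)γ)) holds. -/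
open Finset

/-- Normalized Hamming distance on `[k]^n`. -/
noncomputable def hamK (k n : ℕ) (x y : Fin n → Fin k) : ℝ :=
  ((Finset.univ.filter fun i => x i ≠ y i).card : ℝ) / n

/-- The `k`-ary correlation `γ_k(x,y) = 1 - (k/(k-1))·ρ(x,y)`. -/
noncomputable def gammaK (k n : ℕ) (x y : Fin n → Fin k) : ℝ :=
  1 - ((k : ℝ) / ((k : ℝ) - 1)) * hamK k n x y


lemma chernoff_aux (r d : ℕ) (K z : ℝ) (hK : 0 ≤ K) (hz : 0 < z) (hz1 : z ≤ 1) :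
    z ^ d * ∑ i ∈ Finset.range (d + 1), (r.choose i : ℝ) * K ^ i ≤ (1 + K * z) ^ r := by
  have h1 : (1 + K * z) ^ r = ∑ i ∈ Finset.range (r + 1), (r.choose i : ℝ) * (K * z) ^ i := by
    rw [add_comm, add_pow]
    exact Finset.sum_congr rfl fun i _ => by ring
  have h2 : ∑ i ∈ Finset.range (r + 1), (r.choose i : ℝ) * (K * z) ^ i
      = ∑ i ∈ Finset.range (max r d + 1), (r.choose i : ℝ) * (K * z) ^ i := by
    apply Finset.sum_subset
    · intro i hi
      simp only [Finset.mem_range] at *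
      omega
    · intro i _ hi
      simp only [Finset.mem_range] at hi
      rw [Nat.choose_eq_zero_of_lt (by omega)]
      simp
  rw [h1, h2, Finset.mul_sum]
  calc ∑ i ∈ Finset.range (d + 1), z ^ d * ((r.choose i : ℝ) * K ^ i)
      ≤ ∑ i ∈ Finset.range (d + 1), (r.choose i : ℝ) * (K * z) ^ i := by
        apply Finset.sum_le_sum
        intro i hi
        have hi' : i ≤ d := by simp only [Finset.mem_range] at hi; omega
        have : z ^ d ≤ z ^ i := pow_le_pow_of_le_one hz.le hz1 hi'
        have h3 : 0 ≤ (r.choose i : ℝ) * K ^ i := by positivity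
        rw [mul_pow]
        nlinarith
    _ ≤ _ := by
        apply Finset.sum_le_sum_of_subset_of_nonneg
        · intro i hi
          simp only [Finset.mem_range] at *
          omega
        · intro i _ _
          positivity

/-- number of ordered pairs of `F` agreeing along `f`. -/
lemma pairs_aux {k n r : ℕ} (F : Finset (Fin n → Fin k)) (f : Fin r → Fin n) (S : ℕ)
    (hS : (F.image (fun x => fun j => x (f j))).card ≤ S) :
    F.card ^ 2 ≤ S * ((F ×ˢ F).filter fun p => ∀ j, p.1 (f j) = p.2 (f j)).card := by
  classical
  set φ : (Fin n → Fin k) → (Fin r → Fin k) := fun x => fun j => x (f j) with hφ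
  have h1 : F.card = ∑ b ∈ F.image φ, (F.filter fun a => φ a = b).card :=
    Finset.card_eq_sum_card_image φ F
  have h2 : ((F ×ˢ F).filter fun p => ∀ j, p.1 (f j) = p.2 (f j)).card
      = ∑ b ∈ F.image φ, (F.filter fun a => φ a = b).card ^ 2 := by
    rw [Finset.card_eq_sum_card_fiberwise (f := fun p => φ p.1) (t := F.image φ)]
    · apply Finset.sum_congr rfl
      intro b _
      rw [sq, ← Finset.card_product]
      congr 1
      ext ⟨x, y⟩
      simp only [Finset.mem_filter, Finset.mem_product]
      constructor
      · rintro ⟨⟨⟨hx, hy⟩, h⟩, hb⟩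
        exact ⟨⟨hx, hb⟩, hy, by rw [← hb]; funext j; exact (h j).symm⟩
      · rintro ⟨⟨hx, hb⟩, hy, hb'⟩
        exact ⟨⟨⟨hx, hy⟩, fun j => congrFun (hb.trans hb'.symm) j⟩, hb⟩
    · intro p hp
      have hp' := (Finset.mem_product.1 (Finset.mem_filter.1 hp).1).1
      exact Finset.mem_coe.2 (Finset.mem_image_of_mem φ hp')
  calc F.card ^ 2 = (∑ b ∈ F.image φ, (F.filter fun a => φ a = b).card) ^ 2 := by rw [← h1]
    _ ≤ (F.image φ).card * ∑ b ∈ F.image φ, (F.filter fun a => φ a = b).card ^ 2 :=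
        sq_sum_le_card_mul_sum_sq
    _ ≤ _ := by rw [h2]; exact Nat.mul_le_mul_right _ hS

lemma proj_aux {k n d : ℕ} (hk : 2 ≤ k) (F : Finset (Fin n → Fin k))
    (hSauer : ∀ r : ℕ, r ≤ n → ∀ I : Finset (Fin n), I.card = r →
      (F.image (fun x => fun i : I => x i.1)).card
        ≤ ∑ i ∈ Finset.range (d + 1), r.choose i * k ^ i) (r : ℕ) (f : Fin r → Fin n) :
    (F.image (fun x => fun j => x (f j))).card
      ≤ ∑ i ∈ Finset.range (d + 1), r.choose i * k ^ i := by
  classical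
  set I : Finset (Fin n) := Finset.univ.image f with hI
  have hIr : I.card ≤ r := by
    simpa using (Finset.card_image_le (s := (Finset.univ : Finset (Fin r))) (f := f))
  have hIn : I.card ≤ n := by simpa using Finset.card_le_univ I
  have h1 : F.image (fun x => fun j => x (f j))
      = (F.image (fun x => fun i : I => x i.1)).image
        (fun g => fun j => g ⟨f j, Finset.mem_image_of_mem f (Finset.mem_univ j)⟩) := by
    rw [Finset.image_image]
    rfl
  rw [h1]
  refine Finset.card_image_le.trans ((hSauer I.card hIn I rfl).trans ?_)
  apply Finset.sum_le_sum
  intro i _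
  exact Nat.mul_le_mul_right _ (Nat.choose_le_choose i hIr)

/-- The main counting inequality. -/
lemma count_aux {k n : ℕ} (hn : 0 < n) (F : Finset (Fin n → Fin k)) (r S : ℕ) (β : ℝ)
    (hS : ∀ f : Fin r → Fin n, (F.image (fun x => fun j => x (f j))).card ≤ S)
    (hβ0 : 0 ≤ β)
    (hβ : ∀ x ∈ F, ∀ y ∈ F, x ≠ y →
      ((Finset.univ.filter fun i => x i = y i).card : ℝ) ≤ β * n)
    (hSβ : 2 * (S : ℝ) * β ^ r ≤ 1) : (F.card : ℝ) ≤ 2 * S := by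
  classical
  have h1 : ∑ f : Fin r → Fin n, F.card ^ 2 ≤ ∑ f : Fin r → Fin n,
      S * ((F ×ˢ F).filter fun p => ∀ j, p.1 (f j) = p.2 (f j)).card :=
    Finset.sum_le_sum fun f _ => pairs_aux F f S (hS f)
  have h2 : ∑ f : Fin r → Fin n, ((F ×ˢ F).filter fun p => ∀ j, p.1 (f j) = p.2 (f j)).card
      = ∑ p ∈ F ×ˢ F, (Finset.univ.filter fun i => p.1 i = p.2 i).card ^ r := by
    simp_rw [Finset.card_filter]
    rw [Finset.sum_comm]
    apply Finset.sum_congr rfl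
    intro p _
    rw [← Finset.card_filter, ← Finset.card_filter]
    have : (Finset.univ.filter fun f : Fin r → Fin n => ∀ j, p.1 (f j) = p.2 (f j))
        = Fintype.piFinset fun _ : Fin r => Finset.univ.filter fun i => p.1 i = p.2 i := by
      ext f
      simp
    rw [this, Fintype.card_piFinset]
    simp
  rw [← Finset.mul_sum, h2] at h1
  simp only [Finset.sum_const, Finset.card_univ, Fintype.card_fun, Fintype.card_fin,
    smul_eq_mul] at h1
  have h3 : (n : ℝ) ^ r * (F.card : ℝ) ^ 2 ≤ S * ∑ p ∈ F ×ˢ F,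
      ((Finset.univ.filter fun i => p.1 i = p.2 i).card : ℝ) ^ r := by exact_mod_cast h1
  have hnr : (0 : ℝ) < (n : ℝ) ^ r := by positivity
  have h4 : ∑ p ∈ F ×ˢ F, ((Finset.univ.filter fun i => p.1 i = p.2 i).card : ℝ) ^ r
      ≤ ∑ p ∈ F ×ˢ F, ((if p.1 = p.2 then (n : ℝ) ^ r else 0) + β ^ r * (n : ℝ) ^ r) := by
    apply Finset.sum_le_sum
    rintro ⟨x, y⟩ hp
    obtain ⟨hx, hy⟩ := Finset.mem_product.1 hp
    by_cases hxy : x = y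
    · subst hxy
      simp only [if_true, Finset.filter_true, Finset.card_univ, Fintype.card_fin]
      have : 0 ≤ β ^ r * (n : ℝ) ^ r := by positivity
      linarith
    · simp only [hxy, if_false, zero_add]
      rw [← mul_pow]
      exact pow_le_pow_left₀ (by positivity) (hβ x hx y hy hxy) r
  have h5 : ∑ p ∈ F ×ˢ F, ((if p.1 = p.2 then (n : ℝ) ^ r else 0) + β ^ r * (n : ℝ) ^ r)
      = (n : ℝ) ^ r * (F.card + (F.card : ℝ) ^ 2 * β ^ r) := by
    rw [Finset.sum_add_distrib, Finset.sum_product]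
    have : ∀ x ∈ F, ∑ y ∈ F, (if x = y then (n : ℝ) ^ r else 0) = (n : ℝ) ^ r := by
      intro x hx
      simp [hx]
    simp only
    rw [Finset.sum_congr rfl this]
    simp only [Finset.sum_const, Finset.card_product, nsmul_eq_mul]
    push_cast
    ring
  rw [h5] at h4
  have h6 : (n : ℝ) ^ r * (F.card : ℝ) ^ 2
      ≤ (n : ℝ) ^ r * (S * (F.card + (F.card : ℝ) ^ 2 * β ^ r)) := by
    refine h3.trans ((mul_le_mul_of_nonneg_left h4 (Nat.cast_nonneg S)).trans (le_of_eq ?_))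
    ring
  have h7 := le_of_mul_le_mul_left h6 hnr
  by_contra hcon
  push Not at hcon
  have hm : (0 : ℝ) < F.card := lt_of_le_of_lt (by positivity) hcon
  have h8 : 2 * (S : ℝ) * β ^ r * (F.card : ℝ) ^ 2 ≤ 1 * (F.card : ℝ) ^ 2 :=
    mul_le_mul_of_nonneg_right hSβ (by positivity)
  nlinarith

lemma binH_eq (x : ℝ) : binH x = Real.binEntropy x / Real.log 2 := by
  unfold binH Real.logb
  rw [Real.binEntropy_eq_negMulLog_add_negMulLog_one_sub]
  unfold Real.negMulLog
  ring

set_option maxHeartbeats 1600000 in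
/-- Choice of the sample size `r`. -/
lemma choose_r (k d : ℕ) (hk : 2 ≤ k) (hd : 1 ≤ d) (δ β : ℝ) (hδ0 : 0 < δ) (hδ1 : δ < 1)
    (hβ0 : 0 < β) (hβk : 1 < k * β)
    (hb : δ * Real.log k - δ * Real.log δ - (1 - δ) * Real.log (1 - δ) ≤ - Real.log β) :
    ∃ r : ℕ, 2 * (∑ i ∈ Finset.range (d + 1), (r.choose i : ℝ) * (k : ℝ) ^ i) * β ^ r ≤ 1 ∧
      (∑ i ∈ Finset.range (d + 1), (r.choose i : ℝ) * (k : ℝ) ^ i)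
        ≤ 17 * (k : ℝ) ^ d * (2 : ℝ) ^ ((d : ℝ) / δ) := by
  have hk' : (2 : ℝ) ≤ k := by exact_mod_cast hk
  have hk0 : (0 : ℝ) < k := by linarith
  have h1δ : 0 < 1 - δ := by linarith
  have hd' : (1 : ℝ) ≤ d := by exact_mod_cast hd
  obtain ⟨a, ha⟩ : ∃ a : ℝ, a = k * (1 - δ) / δ := ⟨_, rfl⟩
  have ha0 : 0 < a := by rw [ha]; positivity
  have hla : Real.log a = Real.log k + Real.log (1 - δ) - Real.log δ := by
    rw [ha, Real.log_div (by positivity) hδ0.ne', Real.log_mul hk0.ne' h1δ.ne']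
  have hlk : - Real.log β < Real.log k := by
    have := Real.log_pos hβk
    rw [Real.log_mul hk0.ne' hβ0.ne'] at this
    linarith
  have hlδ : Real.log δ ≤ δ - 1 := Real.log_le_sub_one_of_pos hδ0
  have hl1 : 1 < Real.log a := by
    have : (1 - δ) * 1 < (1 - δ) * Real.log a := by rw [hla]; rw [hla.symm]; nlinarith
    exact lt_of_mul_lt_mul_left this h1δ.le
  have ha1 : 1 ≤ a := by
    by_contra h
    push Not at h
    have := Real.log_nonpos ha0.le h.le
    linarith
  have hl2 := Real.log_two_lt_d9
  have hl20 : 0 < Real.log 2 := Real.log_pos (by norm_num)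
  -- the first requirement
  have key : ∀ r : ℕ, Real.log 2 ≤ (r * δ - d) * Real.log a →
      2 * (∑ i ∈ Finset.range (d + 1), (r.choose i : ℝ) * (k : ℝ) ^ i) * β ^ r ≤ 1 := by
    intro r hr
    have hc := chernoff_aux r d k a⁻¹ hk0.le (by positivity) (inv_le_one_of_one_le₀ ha1)
    set S := ∑ i ∈ Finset.range (d + 1), (r.choose i : ℝ) * (k : ℝ) ^ i with hS
    have hSpos : 0 < S := by
      rw [hS, Finset.sum_range_succ']
      have : 0 ≤ ∑ i ∈ Finset.range d, (r.choose (i + 1) : ℝ) * (k : ℝ) ^ (i + 1) := by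
        positivity
      simp
      linarith
    have h1 : 1 + k * a⁻¹ = (1 - δ)⁻¹ := by
      rw [ha]
      field_simp
      ring
    rw [h1] at hc
    have hc2 := Real.log_le_log (by positivity) hc
    rw [Real.log_mul (by positivity) hSpos.ne', Real.log_pow, Real.log_pow, Real.log_inv,
      Real.log_inv] at hc2
    have h3 : Real.log (2 * S * β ^ r) ≤ 0 := by
      rw [Real.log_mul (by positivity) (by positivity), Real.log_mul (by positivity) hSpos.ne',
        Real.log_pow]
      have hr0 : (0 : ℝ) ≤ r := Nat.cast_nonneg r
      have h4 : δ * Real.log a - Real.log (1 - δ) ≤ - Real.log β := by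
        rw [hla]; linarith
      have h5 := mul_le_mul_of_nonneg_left h4 hr0
      nlinarith
    have h6 : (0 : ℝ) < 2 * S * β ^ r := by positivity
    exact (Real.log_nonpos_iff h6.le).1 h3
  have hSk : ∀ r : ℕ, (∑ i ∈ Finset.range (d + 1), (r.choose i : ℝ) * (k : ℝ) ^ i)
      ≤ (k : ℝ) ^ d * ∑ i ∈ Finset.range (d + 1), (r.choose i : ℝ) * (1 : ℝ) ^ i := by
    intro r
    rw [Finset.mul_sum]
    apply Finset.sum_le_sum
    intro i hi
    have hi' : i ≤ d := by simp only [Finset.mem_range] at hi; omega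
    have : (k : ℝ) ^ i ≤ (k : ℝ) ^ d := pow_le_pow_right₀ (by linarith) hi'
    have h3 : 0 ≤ (r.choose i : ℝ) := by positivity
    simp only [one_pow, mul_one]
    nlinarith
  have hkd : (0 : ℝ) < (k : ℝ) ^ d := by positivity
  obtain ⟨B, hB⟩ : ∃ B : ℝ, B = (d : ℝ) / δ := ⟨_, rfl⟩
  have hB0 : 0 < B := by rw [hB]; positivity
  have hBδ : B * δ = d := by rw [hB]; field_simp
  rw [← hB]
  rcases le_or_gt (1 / 6) δ with hδ6 | hδ6
  · refine ⟨⌊B⌋₊ + 4, key _ ?_, ?_⟩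
    · have h1 : B < ⌊B⌋₊ + 1 := Nat.lt_floor_add_one B
      have h2 : 3 * δ ≤ ((⌊B⌋₊ + 4 : ℕ) : ℝ) * δ - d := by
        rw [← hBδ]; push_cast; nlinarith
      refine le_trans ?_ (mul_le_mul_of_nonneg_right h2 (by linarith))
      rcases le_or_gt (1 / 4) δ with hδ4 | hδ4
      · nlinarith
      · have h4 : 2 * Real.log 2 ≤ Real.log a := by
          have : (2 : ℝ) * Real.log 2 = Real.log (2 ^ 2) := by rw [Real.log_pow]; norm_num
          rw [this]
          apply Real.log_le_log (by norm_num)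
          rw [ha, le_div_iff₀ hδ0]
          nlinarith
        nlinarith
    · have hc := chernoff_aux (⌊B⌋₊ + 4) d 1 1 zero_le_one one_pos le_rfl
      rw [one_pow, one_mul] at hc
      have h2 : ((1 : ℝ) + 1 * 1) ^ (⌊B⌋₊ + 4) ≤ 17 * 2 ^ B := by
        have : ((1 : ℝ) + 1 * 1) ^ (⌊B⌋₊ + 4) = 16 * (2 : ℝ) ^ (⌊B⌋₊ : ℝ) := by
          rw [Real.rpow_natCast, pow_add]; norm_num; ring
        rw [this]
        have h3 : (2 : ℝ) ^ (⌊B⌋₊ : ℝ) ≤ 2 ^ B :=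
          Real.rpow_le_rpow_of_exponent_le (by norm_num) (Nat.floor_le hB0.le)
        have h4 : (0 : ℝ) < 2 ^ B := by positivity
        linarith
      refine (hSk _).trans ?_
      have := mul_le_mul_of_nonneg_left (hc.trans h2) hkd.le
      linarith
  · refine ⟨⌈2 * B⌉₊, key _ ?_, ?_⟩
    · have h1 : 2 * B ≤ ⌈2 * B⌉₊ := Nat.le_ceil _
      have h2 : (1 : ℝ) ≤ (⌈2 * B⌉₊ : ℝ) * δ - d := by nlinarith
      nlinarith
    · set r := ⌈2 * B⌉₊ with hr
      have hrB : (r : ℝ) ≤ 2 * B + 1 := (Nat.ceil_lt_add_one (by positivity)).le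
      have hc := chernoff_aux r d 1 (1 / 8) zero_le_one (by norm_num) (by norm_num)
      set T := ∑ i ∈ Finset.range (d + 1), (r.choose i : ℝ) * (1 : ℝ) ^ i with hT
      have hT2 : T ≤ 8 ^ d * (9 / 8 : ℝ) ^ r := by
        have h8 : (0 : ℝ) < 8 ^ d := by positivity
        have := mul_le_mul_of_nonneg_left hc h8.le
        rw [← mul_assoc, ← mul_pow] at this
        norm_num at this
        exact this
      have h98 : (9 / 8 : ℝ) ≤ (2 : ℝ) ^ (1 / 4 : ℝ) := by
        rw [Real.le_rpow_iff_log_le (by norm_num) (by norm_num)]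
        have : (4 : ℝ) * Real.log (9 / 8) = Real.log ((9 / 8) ^ 4) := by
          rw [Real.log_pow]; norm_num
        have h2 : Real.log ((9 / 8 : ℝ) ^ 4) ≤ Real.log 2 :=
          Real.log_le_log (by norm_num) (by norm_num)
        linarith
      have h9 : (9 / 8 : ℝ) ^ r ≤ (2 : ℝ) ^ ((r : ℝ) / 4) := by
        calc (9 / 8 : ℝ) ^ r ≤ ((2 : ℝ) ^ (1 / 4 : ℝ)) ^ r :=
              pow_le_pow_left₀ (by norm_num) h98 r
          _ = _ := by rw [← Real.rpow_natCast, ← Real.rpow_mul (by norm_num)]; congr 1; ring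
      have h8 : (8 : ℝ) ^ d = (2 : ℝ) ^ (3 * (d : ℝ)) := by
        rw [Real.rpow_mul (by norm_num), Real.rpow_natCast]; norm_num
      have h10 : T ≤ 17 * 2 ^ B := by
        calc T ≤ 8 ^ d * (9 / 8 : ℝ) ^ r := hT2
          _ ≤ (2 : ℝ) ^ (3 * (d : ℝ)) * (2 : ℝ) ^ ((r : ℝ) / 4) := by
              rw [h8]; exact mul_le_mul_of_nonneg_left h9 (by positivity)
          _ = (2 : ℝ) ^ (3 * (d : ℝ) + (r : ℝ) / 4) := by rw [Real.rpow_add (by norm_num)]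
          _ ≤ (2 : ℝ) ^ (B + 1) := by
              apply Real.rpow_le_rpow_of_exponent_le (by norm_num)
              nlinarith
          _ = 2 * 2 ^ B := by rw [Real.rpow_add (by norm_num), Real.rpow_one]; ring
          _ ≤ 17 * 2 ^ B := by
              have h4 : (0 : ℝ) < 2 ^ B := by positivity
              linarith
      refine (hSk _).trans ?_
      have := mul_le_mul_of_nonneg_left h10 hkd.le
      linarith

/-- If `F ⊆ [k]^n` satisfies the generalized Sauer (Haussler–Long) bound with parameter `d`,
`6k/(k+1.6) ≤ d ≤ nk/(k+1.6)`, and every pair of distinct elements has `|γ_k(x,y)| ≤ γ`,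
then `|F| ≤ 34·k^d·2^(d/δ(γ,k))`, where `δ(γ,k)` is the largest `x ∈ [0, k/(k+1)]` with
`x·log₂ k + H(x) ≤ log₂(k/(1+(k-1)γ))`. -/
theorem stmt1 (k n d : ℕ) (hk : 2 ≤ k) (F : Finset (Fin n → Fin k))
    (hd1 : 6 * (k : ℝ) / ((k : ℝ) + 1.6) ≤ (d : ℝ))
    (hd2 : (d : ℝ) ≤ (n : ℝ) * (k : ℝ) / ((k : ℝ) + 1.6))
    (hSauer : ∀ r : ℕ, r ≤ n → ∀ I : Finset (Fin n), I.card = r →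
      (F.image (fun x => fun i : I => x i.1)).card
        ≤ ∑ i ∈ Finset.range (d + 1), r.choose i * k ^ i)
    (γ : ℝ) (hγ0 : 0 < γ) (hγ1 : γ < 1)
    (horth : ∀ x ∈ F, ∀ y ∈ F, x ≠ y → |gammaK k n x y| ≤ γ)
    (δ : ℝ)
    (hδ : IsGreatest {x : ℝ | x ∈ Set.Icc 0 ((k : ℝ) / ((k : ℝ) + 1)) ∧
      x * Real.logb 2 k + binH x ≤ Real.logb 2 ((k : ℝ) / (1 + ((k : ℝ) - 1) * γ))} δ) :
    (F.card : ℝ) ≤ 34 * (k : ℝ) ^ d * (2 : ℝ) ^ ((d : ℝ) / δ) := by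
  have hk' : (2 : ℝ) ≤ k := by exact_mod_cast hk
  have hk0 : (0 : ℝ) < k := by linarith
  have hd : 1 ≤ d := by
    rcases Nat.eq_zero_or_pos d with h | h
    · exfalso
      have : 0 < 6 * (k : ℝ) / ((k : ℝ) + 1.6) := by positivity
      rw [h] at hd1
      norm_num at hd1 this
      linarith
    · exact h
  have hn : 0 < n := by
    rcases Nat.eq_zero_or_pos n with h | h
    · exfalso
      rw [h] at hd2
      have : (1 : ℝ) ≤ d := by exact_mod_cast hd
      norm_num at hd2
      rw [hd2] at hd
      omega
    · exact h
  have hn' : (0 : ℝ) < n := by exact_mod_cast hn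
  have hl20 : 0 < Real.log 2 := Real.log_pos (by norm_num)
  have hc0 : 0 < 1 + ((k : ℝ) - 1) * γ := by nlinarith
  have hck : 1 + ((k : ℝ) - 1) * γ < k := by nlinarith
  obtain ⟨β, hβ⟩ : ∃ β : ℝ, β = (1 + ((k : ℝ) - 1) * γ) / k := ⟨_, rfl⟩
  have hβ0 : 0 < β := by rw [hβ]; positivity
  have hβ1 : β < 1 := by rw [hβ, div_lt_one hk0]; exact hck
  have hβk : 1 < k * β := by
    rw [hβ, mul_div_cancel₀ _ hk0.ne']; nlinarith
  have hβi : (k : ℝ) / (1 + ((k : ℝ) - 1) * γ) = β⁻¹ := by rw [hβ, inv_div]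
  rw [hβi] at hδ
  obtain ⟨⟨⟨hδ0, hδk⟩, hδg⟩, hmax⟩ := hδ
  have hδ1 : δ < 1 := lt_of_le_of_lt hδk (by rw [div_lt_one (by linarith)]; linarith)
  -- positivity of δ
  have hδpos : 0 < δ := by
    have hpos : 0 < Real.logb 2 β⁻¹ :=
      Real.logb_pos (by norm_num) ((one_lt_inv₀ hβ0).2 hβ1)
    have hcont : Continuous fun x : ℝ => x * Real.logb 2 k + binH x := by
      simp_rw [binH_eq]
      have := Real.binEntropy_continuous
      fun_prop
    have h0 : (fun x : ℝ => x * Real.logb 2 k + binH x) 0 < Real.logb 2 β⁻¹ := by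
      simpa [binH] using hpos
    have hev := hcont.continuousAt.eventually_lt continuousAt_const h0
    obtain ⟨ε, hε, hball⟩ := Metric.eventually_nhds_iff.1 hev
    have hkk : 0 < (k : ℝ) / ((k : ℝ) + 1) := by positivity
    have hxpos : 0 < min (ε / 2) ((k : ℝ) / ((k : ℝ) + 1)) := lt_min (by linarith) hkk
    refine lt_of_lt_of_le hxpos (hmax ⟨⟨hxpos.le, min_le_right _ _⟩, le_of_lt (hball ?_)⟩)
    rw [Real.dist_eq, sub_zero, abs_of_pos hxpos]
    exact lt_of_le_of_lt (min_le_left _ _) (by linarith)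
  have hb : δ * Real.log k - δ * Real.log δ - (1 - δ) * Real.log (1 - δ) ≤ - Real.log β := by
    have h := mul_le_mul_of_nonneg_right hδg hl20.le
    unfold binH Real.logb at h
    rw [div_mul_cancel₀ _ hl20.ne', Real.log_inv] at h
    refine le_trans (le_of_eq ?_) h
    field_simp
    ring
  obtain ⟨r, hr1, hr2⟩ := choose_r k d hk hd δ β hδpos hδ1 hβ0 hβk hb
  have hmain := count_aux hn F r (∑ i ∈ Finset.range (d + 1), r.choose i * k ^ i) β
    (proj_aux hk F hSauer r) hβ0.le ?_ ?_
  · push_cast at hmain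
    linarith
  · intro x hx y hy hxy
    have h1 := (abs_le.1 (horth x hx y hy hxy)).2
    unfold gammaK hamK at h1
    have h2 : (Finset.univ.filter fun i => x i = y i).card
        + (Finset.univ.filter fun i => x i ≠ y i).card = n := by
      have := Finset.card_filter_add_card_filter_not (s := (Finset.univ : Finset (Fin n)))
        (fun i => x i = y i)
      simpa using this
    have h3 : ((Finset.univ.filter fun i => x i = y i).card : ℝ)
        + ((Finset.univ.filter fun i => x i ≠ y i).card : ℝ) = n := by exact_mod_cast h2
    set A := ((Finset.univ.filter fun i => x i = y i).card : ℝ) with hA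
    have h4 : ((Finset.univ.filter fun i => x i ≠ y i).card : ℝ) = n - A := by linarith
    rw [h4] at h1
    have hk1 : (0 : ℝ) < k - 1 := by linarith
    have h5 : 1 - (k : ℝ) / (k - 1) * ((n - A) / n)
        = ((k - 1) * n - k * (n - A)) / ((k - 1) * n) := by field_simp
    rw [h5, div_le_iff₀ (by positivity)] at h1
    rw [hβ, div_mul_eq_mul_div, le_div_iff₀ hk0]
    nlinarith
  · push_cast
    exact hr1
end
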